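/- arXiv:1801.05849 — 3 statements merged into one kernel-verified Lean document; each statement's English description precedes it below -/
import Mathlib

section
/- Let Ā ∈ {0,1}^{n×n} and C̄ ∈ {0,1}^{m×n} be patterns, let G = (V, E) be a directed communication graph on V = {1,…,m} with pattern W̄(G) ∈ {0,1}^{m×m} given by W̄(G)_{ij} = 1 iff (j,i) ∈ E, and let N_i^- = {j : (j,i) ∈ E}. Let Ã̄(G) = [[Ā, 0],[C̄, W̄(G)]] be the augmented pattern and let C̃̄_i be the augmented output pattern with sensor-selection set J_i = N_i^-. If the pattern pair (Ã̄(G), C̃̄_i) is structurally observable for every i = 1,…,m, then the digraph D(W̄(G)) on the m sensor vertices is strongly connected. -/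
open Matrix

/-- The observability matrix of the pair `(A, C)`, obtained by stacking
`C, C*A, …, C*A^(card N - 1)`. -/
noncomputable def obsMat {N M : Type*} [Fintype N] [DecidableEq N] [Fintype M]
    (A : Matrix N N ℝ) (C : Matrix M N ℝ) :
    Matrix (Fin (Fintype.card N) × M) N ℝ :=
  Matrix.of fun p j => (C * A ^ (p.1 : ℕ)) p.2 j

/-- A pair `(A, C)` is observable if its observability matrix has full column rank. -/
def IsObservable {N M : Type*} [Fintype N] [DecidableEq N] [Fintype M]
    (A : Matrix N N ℝ) (C : Matrix M N ℝ) : Prop :=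
  (obsMat A C).rank = Fintype.card N

/-- A pattern pair is structurally observable if some real realization respecting the
zero pattern is observable. -/
def StructObservable {N M : Type*} [Fintype N] [DecidableEq N] [Fintype M]
    (Ab : Matrix N N Bool) (Cb : Matrix M N Bool) : Prop :=
  ∃ (A : Matrix N N ℝ) (C : Matrix M N ℝ),
    (∀ i j, Ab i j = false → A i j = 0) ∧
    (∀ i j, Cb i j = false → C i j = 0) ∧
    IsObservable A C

/-- The augmented pattern `Ã̄ = [[Ā, 0], [C̄, W̄]]`. -/
def augAb {n m : ℕ} (Ab : Matrix (Fin n) (Fin n) Bool) (Cb : Matrix (Fin m) (Fin n) Bool)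
    (Wb : Matrix (Fin m) (Fin m) Bool) :
    Matrix (Fin n ⊕ Fin m) (Fin n ⊕ Fin m) Bool :=
  Matrix.of fun r c =>
    match r, c with
    | Sum.inl i, Sum.inl j => Ab i j
    | Sum.inl _, Sum.inr _ => false
    | Sum.inr i, Sum.inl j => Cb i j
    | Sum.inr i, Sum.inr j => Wb i j

/-- The augmented output pattern `C̃̄ᵢ = [[c̄ᵢᵀ, 0], [0, I_m^J]]` for the sensor-selection
set `J ⊆ {1,…,m}`. -/
def augCb {n m : ℕ} (Cb : Matrix (Fin m) (Fin n) Bool) (i : Fin m) (J : Finset (Fin m)) :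
    Matrix (Unit ⊕ {j // j ∈ J}) (Fin n ⊕ Fin m) Bool :=
  Matrix.of fun r c =>
    match r, c with
    | Sum.inl _, Sum.inl k => Cb i k
    | Sum.inl _, Sum.inr _ => false
    | Sum.inr _, Sum.inl _ => false
    | Sum.inr j, Sum.inr k => decide ((j : Fin m) = k)

/-- `Wb i j = true` iff `(j, i) ∈ E`, so `Nᵢ⁻ = {j | Wb i j = true}` and the
digraph `D(W̄(G))` has edge `a → b` iff `Wb b a = true`.  If the augmented pattern pair
`(Ã̄(G), C̃̄ᵢ)` (with `Jᵢ = Nᵢ⁻`) is structurally observable for every sensor `i`, then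
`D(W̄(G))` is strongly connected. -/
theorem stmt3 {n m : ℕ} (Ab : Matrix (Fin n) (Fin n) Bool) (Cb : Matrix (Fin m) (Fin n) Bool)
    (Wb : Matrix (Fin m) (Fin m) Bool)
    (h : ∀ i : Fin m,
      StructObservable (augAb Ab Cb Wb)
        (augCb Cb i (Finset.univ.filter fun j => Wb i j = true))) :
    ∀ u v : Fin m, Relation.ReflTransGen (fun a b => Wb b a = true) u v := by
  classical
  intro u v
  by_contra huv
  obtain ⟨A, C, hA, hC, hobs⟩ := h v
  -- column `u` of every power of `A` is supported on sensors which do not reach `v`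
  have key : ∀ (k : ℕ) (r : Fin n ⊕ Fin m), (A ^ k) r (Sum.inr u) ≠ 0 →
      ∃ s, r = Sum.inr s ∧ ¬ Relation.ReflTransGen (fun a b => Wb b a = true) s v := by
    intro k
    induction k with
    | zero =>
      intro r hr
      by_cases hru : r = Sum.inr u
      · exact ⟨u, hru, huv⟩
      · exact absurd (by rw [pow_zero, Matrix.one_apply_ne hru]) hr
    | succ k ih =>
      intro r hr
      rw [pow_succ', Matrix.mul_apply] at hr
      obtain ⟨t, -, ht⟩ := Finset.exists_ne_zero_of_sum_ne_zero hr
      obtain ⟨s, rfl, hs⟩ := ih t (right_ne_zero_of_mul ht)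
      have hAr : A r (Sum.inr s) ≠ 0 := left_ne_zero_of_mul ht
      rcases r with r | r
      · exact absurd (hA _ _ rfl) hAr
      · refine ⟨r, rfl, fun hrv => hs (Relation.ReflTransGen.head ?_ hrv)⟩
        by_contra hW
        exact hAr (hA _ _ (by simpa [augAb] using hW))
  have hzero : (obsMat A C) *ᵥ (Pi.single (Sum.inr u) 1) = 0 := by
    ext p
    rw [Matrix.mulVec_single_one]
    change (C * A ^ (p.1 : ℕ)) p.2 (Sum.inr u) = 0
    rw [Matrix.mul_apply]
    refine Finset.sum_eq_zero fun t _ => ?_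
    by_contra ht
    obtain ⟨s, rfl, hs⟩ := key _ t (right_ne_zero_of_mul ht)
    have hCr := left_ne_zero_of_mul ht
    rcases p with ⟨p, q | ⟨q, hq⟩⟩
    · exact hCr (hC _ _ rfl)
    · apply hCr
      apply hC
      have hqv : Wb v q = true := by simpa using hq
      have : q ≠ s := by
        rintro rfl
        exact hs (Relation.ReflTransGen.single hqv)
      simpa [augCb] using this
  have hrn := LinearMap.finrank_range_add_finrank_ker (obsMat A C).mulVecLin
  have hr : Module.finrank ℝ (LinearMap.range (obsMat A C).mulVecLin)
      = Fintype.card (Fin n ⊕ Fin m) := hobs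
  rw [hr, Module.finrank_fintype_fun_eq_card] at hrn
  have hk : LinearMap.ker (obsMat A C).mulVecLin = ⊥ :=
    Submodule.finrank_eq_zero.mp (by omega)
  have hmem : (Pi.single (Sum.inr u) 1 : Fin n ⊕ Fin m → ℝ) ∈
      LinearMap.ker (obsMat A C).mulVecLin := hzero
  rw [hk, Submodule.mem_bot] at hmem
  have := congrFun hmem (Sum.inr u)
  simp at this
end

section
/- A pattern pair (Ā ∈ {0,1}^{n×n}, C̄ ∈ {0,1}^{m×n}) is structurally observable if and only if the following two conditions both hold: (i) in the state–output digraph D(Ā, C̄), from every state vertex x_i there is a directed path to some output vertex y_j; and (ii) the bipartite representation B(Ā, C̄) admits a matching in which every left state vertex is matched (equivalently, there exists a maximum matching with no left-unmatched vertices). -/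
open Matrix

/-- Edge relation of the state–output digraph `D(Ā, C̄)`: `xᵢ → xⱼ` iff `Ā j i = 1`,
and `xᵢ → yⱼ` iff `C̄ j i = 1`; output vertices have no outgoing edges. -/
def soEdgeB {n m : ℕ} (Ab : Matrix (Fin n) (Fin n) Bool) (Cb : Matrix (Fin m) (Fin n) Bool) :
    (Fin n ⊕ Fin m) → (Fin n ⊕ Fin m) → Prop
  | Sum.inl i, Sum.inl j => Ab j i = true
  | Sum.inl i, Sum.inr j => Cb j i = true
  | Sum.inr _, _ => False

theorem core_zero {Z Q : Type*} [Fintype Z] [DecidableEq Z] [Fintype Q] [DecidableEq Q]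
    (σ : Equiv.Perm Z) (κ : Z → Q) (hκ : ∀ a b, κ a = κ b ↔ σ.SameCycle a b)
    (e p : Q → Z) (d : Q → ℕ) (he : ∀ q, d q ≠ 0 → κ (e q) = q)
    (hp : ∀ q, d q ≠ 0 → d (κ (p q)) < d q)
    (w : Q → ℝ) (hw : ∀ q, 0 < w q) (hwi : Function.Injective w)
    (l : ℂ) (v : Z → ℂ) (hout : ∀ q, d q = 0 → ∃ z, κ z = q ∧ v z = 0)
    (heq : ∀ z, l * v (σ z) = w (κ z) * v z +
      ∑ q, if d q ≠ 0 ∧ p q = σ z then v (e q) else 0) : v = 0 := by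
  classical
  have hks : ∀ z, κ (σ z) = κ z := fun z => (hκ _ _).2 ⟨-1, by simp⟩
  by_contra hv
  let T : Q → Prop := fun q => ∃ z, κ z = q ∧ v z ≠ 0
  have hnT : ∀ q z, ¬ T q → κ z = q → v z = 0 := by
    intro q z h hz
    by_contra h0
    exact h ⟨z, hz, h0⟩
  let r : Q → Q → Prop := fun a b => d a ≠ 0 ∧ κ (p a) = b
  have hrd : ∀ a b, r a b → d b < d a := by
    rintro a b ⟨h1, rfl⟩
    exact hp a h1
  have hTne : ∃ q, T q := by
    by_contra h
    push Not at h
    exact hv (funext fun z => hnT _ z (h _) rfl)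
  -- sources
  have hsrc : ∀ q, T q → (∀ P, T P → ¬ r P q) → l ≠ 0 ∧ ‖l‖ = w q := by
    intro q hq hno
    have hstep : ∀ z, κ z = q → l * v (σ z) = w q * v z := by
      intro z hz
      rw [heq z, hz, Finset.sum_eq_zero, add_zero]
      intro q' _
      split_ifs with h
      · apply hnT q' _ _ (he q' h.1)
        intro hT
        exact hno q' hT ⟨h.1, by rw [h.2, hks, hz]⟩
      · rfl
    obtain ⟨z, hz, hvz⟩ := hq
    have hiter : ∀ k : ℕ, κ ((σ ^ k) z) = q ∧ l ^ k * v ((σ ^ k) z) = (w q : ℂ) ^ k * v z := by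
      intro k
      induction k with
      | zero => simp [hz]
      | succ k ih =>
        have h1 : (σ ^ (k+1)) z = σ ((σ ^ k) z) := by rw [pow_succ']; rfl
        rw [h1]
        refine ⟨by rw [hks]; exact ih.1, ?_⟩
        have := hstep _ ih.1
        linear_combination (l ^ k) * this + (w q : ℂ) * ih.2
    have hk := (hiter (orderOf σ)).2
    have hpos : 0 < orderOf σ := orderOf_pos σ
    rw [pow_orderOf_eq_one] at hk
    have hk2 : l ^ orderOf σ = (w q : ℂ) ^ orderOf σ := mul_right_cancel₀ hvz hk
    have hk3 : ‖l‖ ^ orderOf σ = (w q) ^ orderOf σ := by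
      have := congrArg norm hk2
      rw [norm_pow, norm_pow, Complex.norm_real, Real.norm_of_nonneg (hw q).le] at this
      exact this
    have hk4 : ‖l‖ = w q := (pow_left_inj₀ (norm_nonneg _) (hw q).le hpos.ne').1 hk3
    refine ⟨?_, hk4⟩
    rintro rfl
    have := hw q
    rw [← hk4] at this
    simp at this
  obtain ⟨K, hKT, hKmax⟩ : ∃ K, T K ∧ ∀ q, T q → d q ≤ d K := by
    obtain ⟨q0, h0⟩ := hTne
    obtain ⟨K, hK, hm⟩ := Finset.exists_max_image (Finset.univ.filter T) d ⟨q0, by simp [h0]⟩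
    exact ⟨K, by simpa using hK, fun q hq => hm q (by simpa using hq)⟩
  have hKno : ∀ P, T P → ¬ r P K := fun P hP h => absurd (hrd _ _ h) (not_lt.2 (hKmax P hP))
  obtain ⟨hl, hlK⟩ := hsrc K hKT hKno
  have hchain : ∀ N q, T q → d K - d q ≤ N → Relation.ReflTransGen r K q := by
    intro N
    induction N with
    | zero =>
      intro q hq hd
      by_cases h : ∃ P, T P ∧ r P q
      · obtain ⟨P, hP, hr⟩ := h
        have := hrd _ _ hr
        have := hKmax P hP
        omega
      · push Not at h
        have := (hsrc q hq h).2
        rw [hwi (hlK.symm.trans this)]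
    | succ N ih =>
      intro q hq hd
      by_cases h : ∃ P, T P ∧ r P q
      · obtain ⟨P, hP, hr⟩ := h
        have h1 := hrd _ _ hr
        have h2 := hKmax P hP
        exact (ih P hP (by omega)).tail hr
      · push Not at h
        have := (hsrc q hq h).2
        rw [hwi (hlK.symm.trans this)]
  have hmono : ∀ a b, Relation.ReflTransGen r a b → d b ≤ d a := by
    intro a b h
    induction h with
    | refl => exact le_rfl
    | tail _ h2 ih => exact (hrd _ _ h2).le.trans ih
  have hru : Relator.RightUnique r := by
    rintro a b c ⟨_, h1⟩ ⟨_, h2⟩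
    exact h1.symm.trans h2
  have hone : ∀ a b c, r a c → r b c → Relation.ReflTransGen r a b → a = b := by
    intro a b c ha hb h
    rcases h.cases_head with h | ⟨x, hx, hxb⟩
    · exact h
    · have := hru hx ha
      subst this
      have h1 := hmono _ _ hxb
      have h2 := hrd _ _ hb
      omega
  have huniq : ∀ a b c, T a → T b → r a c → r b c → a = b := by
    intro a b c hTa hTb ha hb
    rcases Relation.ReflTransGen.total_of_right_unique hru
      (hchain _ a hTa le_rfl) (hchain _ b hTb le_rfl) with h | h
    · exact hone a b c ha hb h
    · exact (hone b a c hb ha h).symm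
  have hall : ∀ q, T q → ∀ z, κ z = q → v z ≠ 0 := by
    intro q hq
    obtain ⟨z0, hz0, hin⟩ : ∃ z0, κ z0 = q ∧ ∀ z, κ z = q → σ z ≠ z0 →
        l * v (σ z) = w q * v z := by
      have key : ∀ z0, (∀ P, T P → r P q → p P = z0) → ∀ z, κ z = q → σ z ≠ z0 →
        l * v (σ z) = w q * v z := by
        intro z0 H z hz hne
        rw [heq z, hz, Finset.sum_eq_zero, add_zero]
        intro q' _
        split_ifs with h
        · apply hnT q' _ _ (he q' h.1)
          intro hT
          exact hne (h.2 ▸ H q' hT ⟨h.1, by rw [h.2, hks, hz]⟩)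
        · rfl
      by_cases h : ∃ P, T P ∧ r P q
      · obtain ⟨P, hP, hr⟩ := h
        exact ⟨p P, hr.2, key _ fun P' hP' hr' => by rw [huniq _ _ _ hP' hP hr' hr]⟩
      · push Not at h
        obtain ⟨z, hz, _⟩ := hq
        exact ⟨z, hz, key _ fun P' hP' hr' => absurd hr' (h P' hP')⟩
    have hwq : (w q : ℂ) ≠ 0 := by exact_mod_cast (hw q).ne'
    have hiter : ∀ k : ℕ, κ ((σ ^ k) z0) = q ∧ (v ((σ ^ k) z0) = 0 ↔ v z0 = 0) := by
      intro k
      induction k with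
      | zero => simp [hz0]
      | succ k ih =>
        have h1 : (σ ^ (k+1)) z0 = σ ((σ ^ k) z0) := by rw [pow_succ']; rfl
        rw [h1]
        refine ⟨by rw [hks]; exact ih.1, ?_⟩
        by_cases hc : σ ((σ ^ k) z0) = z0
        · rw [hc]
        · have := hin _ ih.1 hc
          rw [← ih.2]
          constructor
          · intro h
            rw [h, mul_zero] at this
            exact (mul_eq_zero.1 this.symm).resolve_left hwq
          · intro h
            rw [h, mul_zero] at this
            exact (mul_eq_zero.1 this).resolve_left hl
    have hiff : ∀ z, κ z = q → (v z = 0 ↔ v z0 = 0) := by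
      intro z hz
      obtain ⟨i, -, hi⟩ := ((hκ z0 z).1 (hz0.trans hz.symm)).exists_pow_eq'
      rw [← hi]
      exact (hiter i).2
    obtain ⟨y, hy, hvy⟩ := hq
    intro z hz h
    exact hvy ((hiff y hy).2 ((hiff z hz).1 h))
  obtain ⟨M, hMT, hMmin⟩ : ∃ K, T K ∧ ∀ q, T q → d K ≤ d q := by
    obtain ⟨K, hK, hm⟩ := Finset.exists_min_image (Finset.univ.filter T) d ⟨K, by simp [hKT]⟩
    exact ⟨K, by simpa using hK, fun q hq => hm q (by simpa using hq)⟩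
  have hdM : d M ≠ 0 := by
    intro h
    obtain ⟨z, hz, h0⟩ := hout M h
    exact hall M hMT z hz h0
  have hnq : ¬ T (κ (p M)) := fun h => absurd (hp M hdM) (not_lt.2 (hMmin _ h))
  have hE := heq (σ.symm (p M))
  have hkz : κ (σ.symm (p M)) = κ (p M) := by
    rw [← hks (σ.symm (p M)), Equiv.apply_symm_apply]
  rw [hnT _ _ hnq hkz, Equiv.apply_symm_apply, hnT _ _ hnq rfl, Finset.sum_eq_single M] at hE
  · simp only [mul_zero, zero_add, hdM, ne_eq, not_false_eq_true, and_self, if_true] at hE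
    exact hall M hMT _ (he M hdM) hE.symm
  · intro b _ hb
    split_ifs with h
    · apply hnT b _ _ (he b h.1)
      intro hT
      exact hb (huniq b M (κ (p M)) hT hMT ⟨h.1, by rw [h.2]⟩ ⟨hdM, rfl⟩)
    · rfl
  · simp

theorem obs_inj {n m : ℕ} {A : Matrix (Fin n) (Fin n) ℝ} {C : Matrix (Fin m) (Fin n) ℝ} :
    IsObservable A C ↔ ∀ v : Fin n → ℝ, (∀ k : ℕ, (C * A ^ k) *ᵥ v = 0) → v = 0 := by
  have hpow : ∀ v : Fin n → ℝ, (∀ k < n, (C * A ^ k) *ᵥ v = 0) → ∀ k : ℕ, (C * A ^ k) *ᵥ v = 0 := by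
    intro v hv k
    by_cases hn : n = 0
    · subst hn
      rw [Subsingleton.elim v 0, Matrix.mulVec_zero]
    have : NeZero n := ⟨hn⟩
    rw [Matrix.pow_eq_aeval_mod_charpoly, Polynomial.aeval_eq_sum_range, Matrix.mul_sum,
      Matrix.sum_mulVec]
    apply Finset.sum_eq_zero
    intro i hi
    rw [Matrix.mul_smul, Matrix.smul_mulVec]
    by_cases hin : i < n
    · rw [hv i hin, smul_zero]
    · rw [Polynomial.coeff_eq_zero_of_degree_lt, zero_smul]
      refine (Polynomial.degree_modByMonic_lt _ (Matrix.charpoly_monic A)).trans_le ?_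
      rw [Matrix.charpoly_degree_eq_dim, Fintype.card_fin]
      exact_mod_cast not_lt.1 hin
  have hobs : ∀ v : Fin n → ℝ, obsMat A C *ᵥ v = 0 ↔ ∀ k < n, (C * A ^ k) *ᵥ v = 0 := by
    intro v
    constructor
    · intro h k hk
      funext j
      have := congrFun h (⟨k, by simpa using hk⟩, j)
      simpa [obsMat, Matrix.mulVec, dotProduct] using this
    · intro h
      funext ⟨k, j⟩
      have := congrFun (h k (by simpa using k.2)) j
      simpa [obsMat, Matrix.mulVec, dotProduct] using this
  have hrk : IsObservable A C ↔ LinearMap.ker (obsMat A C).mulVecLin = ⊥ := by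
    unfold IsObservable Matrix.rank
    have := LinearMap.finrank_range_add_finrank_ker (obsMat A C).mulVecLin
    rw [Module.finrank_fintype_fun_eq_card] at this
    rw [← Submodule.finrank_eq_zero (R := ℝ)]
    omega
  rw [hrk, LinearMap.ker_eq_bot']
  simp only [Matrix.mulVecLin_apply, hobs]
  exact ⟨fun h v hv => h v fun k _ => hv k, fun h v hv => h v (hpow v hv)⟩

theorem nec_reach {n m : ℕ} (Ab : Matrix (Fin n) (Fin n) Bool)
    (Cb : Matrix (Fin m) (Fin n) Bool) (A : Matrix (Fin n) (Fin n) ℝ) (C : Matrix (Fin m) (Fin n) ℝ)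
    (hA : ∀ i j, Ab i j = false → A i j = 0) (hC : ∀ i j, Cb i j = false → C i j = 0)
    (h : ∀ v : Fin n → ℝ, (∀ k : ℕ, (C * A ^ k) *ᵥ v = 0) → v = 0) (i : Fin n) :
    ∃ j : Fin m, Relation.ReflTransGen (soEdgeB Ab Cb) (Sum.inl i) (Sum.inr j) := by
  by_contra hi
  let S : Fin n → Prop := fun i =>
    ¬ ∃ j : Fin m, Relation.ReflTransGen (soEdgeB Ab Cb) (Sum.inl i) (Sum.inr j)
  have hSA : ∀ i j, S i → ¬ S j → A j i = 0 := by
    intro i j hi hj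
    apply hA
    by_contra hne
    rw [Bool.not_eq_false] at hne
    obtain ⟨y, hy⟩ := not_not.1 hj
    exact hi ⟨y, hy.head (show soEdgeB Ab Cb (Sum.inl i) (Sum.inl j) from hne)⟩
  have hSC : ∀ i j, S i → C j i = 0 := by
    intro i j hi
    apply hC
    by_contra hne
    rw [Bool.not_eq_false] at hne
    exact hi ⟨j, Relation.ReflTransGen.single (show soEdgeB Ab Cb (Sum.inl i) (Sum.inr j) from hne)⟩
  have hv : ∀ k : ℕ, ∀ v : Fin n → ℝ, (∀ j, ¬ S j → v j = 0) → (C * A ^ k) *ᵥ v = 0 := by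
    intro k
    induction k with
    | zero =>
      intro v hv
      funext y
      simp only [pow_zero, Matrix.mul_one, Matrix.mulVec, dotProduct, Pi.zero_apply]
      apply Finset.sum_eq_zero
      intro x _
      by_cases hx : S x
      · rw [hSC x y hx, zero_mul]
      · rw [hv x hx, mul_zero]
    | succ k ih =>
      intro v hv
      rw [pow_succ, ← Matrix.mul_assoc, ← Matrix.mulVec_mulVec]
      apply ih
      intro j hj
      simp only [Matrix.mulVec, dotProduct]
      apply Finset.sum_eq_zero
      intro x _
      by_cases hx : S x
      · rw [hSA x j hx hj, zero_mul]
      · rw [hv x hx, mul_zero]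
  have h0 := h (Pi.single i 1) fun k => hv k _ fun j hj => by
    rw [Pi.single_apply, if_neg]
    rintro rfl
    exact hj hi
  have := congrFun h0 i
  simp at this

theorem nec_match {n m : ℕ} (Ab : Matrix (Fin n) (Fin n) Bool)
    (Cb : Matrix (Fin m) (Fin n) Bool) (A : Matrix (Fin n) (Fin n) ℝ) (C : Matrix (Fin m) (Fin n) ℝ)
    (hA : ∀ i j, Ab i j = false → A i j = 0) (hC : ∀ i j, Cb i j = false → C i j = 0)
    (h : ∀ v : Fin n → ℝ, (∀ k : ℕ, (C * A ^ k) *ᵥ v = 0) → v = 0) :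
    ∃ f : Fin n → Fin n ⊕ Fin m,
          Function.Injective f ∧ ∀ i : Fin n, soEdgeB Ab Cb (Sum.inl i) (f i) := by
  let B : Matrix (Fin n ⊕ Fin m) (Fin n) ℝ := Matrix.fromRows A C
  have hB : ∀ v, B *ᵥ v = 0 → v = 0 := by
    intro v hv
    rw [Matrix.fromRows_mulVec] at hv
    have h1 : A *ᵥ v = 0 := funext fun i => congrFun hv (Sum.inl i)
    have h2 : C *ᵥ v = 0 := funext fun i => congrFun hv (Sum.inr i)
    apply h
    intro k
    cases k with
    | zero => simpa using h2
    | succ k => rw [pow_succ, ← Matrix.mul_assoc, ← Matrix.mulVec_mulVec, h1, Matrix.mulVec_zero]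
  have hrank : B.rank = n := by
    have hk : LinearMap.ker B.mulVecLin = ⊥ := LinearMap.ker_eq_bot'.2 hB
    have := LinearMap.finrank_range_add_finrank_ker B.mulVecLin
    rw [Module.finrank_fintype_fun_eq_card, hk, finrank_bot, Fintype.card_fin] at this
    exact this
  -- choose n independent rows
  obtain ⟨g, hg⟩ : ∃ g : Fin n → Fin n ⊕ Fin m, LinearIndependent ℝ (fun i => B.row (g i)) := by
    rw [Matrix.rank_eq_finrank_span_row] at hrank
    obtain ⟨ι, a, ha, hspan, hli⟩ := exists_linearIndependent' ℝ B.row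
    have : Fintype ι := Fintype.ofInjective a ha
    rw [← hspan, finrank_span_eq_card hli] at hrank
    exact ⟨fun i => a ((Fintype.equivFinOfCardEq hrank).symm i),
      hli.comp _ (Fintype.equivFinOfCardEq hrank).symm.injective⟩
  have hdet : (B.submatrix g id).det ≠ 0 := by
    have : IsUnit (B.submatrix g id) := Matrix.linearIndependent_rows_iff_isUnit.1 hg
    exact ((Matrix.isUnit_iff_isUnit_det _).1 this).ne_zero
  obtain ⟨τ, hτ⟩ : ∃ τ : Equiv.Perm (Fin n), ∀ i, B (g (τ i)) i ≠ 0 := by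
    by_contra hno
    push Not at hno
    apply hdet
    rw [Matrix.det_apply]
    apply Finset.sum_eq_zero
    intro τ _
    obtain ⟨i, hi⟩ := hno τ
    rw [Finset.prod_eq_zero (Finset.mem_univ i) (by simpa using hi), smul_zero]
  refine ⟨fun i => g (τ i), ?_, ?_⟩
  · intro a b hab
    apply τ.injective
    apply hg.injective
    simp only at hab
    simp only [hab]
  · intro i
    have hi := hτ i
    show soEdgeB Ab Cb (Sum.inl i) (g (τ i))
    generalize g (τ i) = z at hi ⊢
    rcases z with j | j
    · show Ab j i = true
      by_contra hne
      exact hi (hA j i (by simpa using hne))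
    · show Cb j i = true
      by_contra hne
      exact hi (hC j i (by simpa using hne))

theorem exists_eig {n m : ℕ} (A : Matrix (Fin n) (Fin n) ℝ) (C : Matrix (Fin m) (Fin n) ℝ)
    (v0 : Fin n → ℝ) (hne : ¬ v0 = 0) (hv0 : ∀ k : ℕ, (C * A ^ k) *ᵥ v0 = 0) :
    ∃ (l : ℂ) (v : Fin n → ℂ), v ≠ 0 ∧ (A.map ((↑) : ℝ → ℂ)) *ᵥ v = l • v ∧
      (C.map ((↑) : ℝ → ℂ)) *ᵥ v = 0 := by
  let A' : Matrix (Fin n) (Fin n) ℂ := A.map (Complex.ofRealHom)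
  let C' : Matrix (Fin m) (Fin n) ℂ := C.map (Complex.ofRealHom)
  let V : Submodule ℂ (Fin n → ℂ) := ⨅ k : ℕ, LinearMap.ker (C' * A' ^ k).mulVecLin
  have hmem : ∀ v, v ∈ V ↔ ∀ k : ℕ, (C' * A' ^ k) *ᵥ v = 0 := by
    intro v
    simp [V, Submodule.mem_iInf]
  have hinv : ∀ v ∈ V, A'.mulVecLin v ∈ V := by
    intro v hv
    rw [hmem] at hv ⊢
    intro k
    rw [Matrix.mulVecLin_apply, Matrix.mulVec_mulVec, Matrix.mul_assoc, ← pow_succ]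
    exact hv (k + 1)
  have hv1 : (fun i => (v0 i : ℂ)) ∈ V := by
    rw [hmem]
    intro k
    have h1 : C' * A' ^ k = (C * A ^ k).map Complex.ofRealHom := by
      rw [Matrix.map_mul, Matrix.map_pow]
    rw [h1]
    funext j
    have h2 := congrArg (fun x : ℝ => (x : ℂ)) (congrFun (hv0 k) j)
    simpa [Matrix.mulVec, dotProduct] using h2
  have hnt : Nontrivial V := by
    refine ⟨⟨⟨_, hv1⟩, 0, ?_⟩⟩
    intro h
    apply hne
    funext i
    have := congrFun (congrArg Subtype.val h) i
    simpa using this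
  obtain ⟨l, hl⟩ := Module.End.exists_eigenvalue (A'.mulVecLin.restrict hinv)
  obtain ⟨v, hv⟩ := hl.exists_hasEigenvector
  refine ⟨l, v, ?_, ?_, ?_⟩
  · intro h
    exact hv.2 (Subtype.ext h)
  · have := congrArg Subtype.val hv.apply_eq_smul
    exact this
  · have := (hmem v).1 v.2 0
    rw [pow_zero, Matrix.mul_one] at this
    exact this

def levelR {n m : ℕ} (Ab : Matrix (Fin n) (Fin n) Bool) (Cb : Matrix (Fin m) (Fin n) Bool) :
    ℕ → (Fin n ⊕ Fin m) → Prop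
  | 0, z => ∃ y, z = Sum.inr y
  | k + 1, z => ∃ z', soEdgeB Ab Cb z z' ∧ levelR Ab Cb k z'

theorem suff {n m : ℕ} (Ab : Matrix (Fin n) (Fin n) Bool)
    (Cb : Matrix (Fin m) (Fin n) Bool)
    (hreach : ∀ i : Fin n, ∃ j : Fin m,
          Relation.ReflTransGen (soEdgeB Ab Cb) (Sum.inl i) (Sum.inr j))
    (f : Fin n → Fin n ⊕ Fin m) (hf : Function.Injective f)
    (hfe : ∀ i : Fin n, soEdgeB Ab Cb (Sum.inl i) (f i)) : StructObservable Ab Cb := by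
  classical
  have hlev : ∀ z, ∃ k, levelR Ab Cb k z := by
    have aux : ∀ z j, Relation.ReflTransGen (soEdgeB Ab Cb) z (Sum.inr j) →
        ∃ k, levelR Ab Cb k z := by
      intro z j h
      induction h using Relation.ReflTransGen.head_induction_on with
      | refl => exact ⟨0, j, rfl⟩
      | head h1 _ ih =>
        obtain ⟨k, hk⟩ := ih
        exact ⟨k + 1, _, h1, hk⟩
    rintro (i | y)
    · obtain ⟨j, hj⟩ := hreach i
      exact aux _ j hj
    · exact ⟨0, y, rfl⟩
  obtain ⟨σ, hσ⟩ : ∃ σ : Equiv.Perm (Fin n ⊕ Fin m), ∀ i, σ (Sum.inl i) = f i := by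
    obtain ⟨σ, hσ⟩ := Equiv.Perm.exists_extending_pair (Sum.inl : Fin n → Fin n ⊕ Fin m) f
      Sum.inl_injective hf
    exact ⟨σ, fun i => by simpa using hσ i⟩
  let Q := Quotient (Equiv.Perm.SameCycle.setoid σ)
  let κ : Fin n ⊕ Fin m → Q := fun z => Quotient.mk _ z
  have hκ : ∀ a b, κ a = κ b ↔ σ.SameCycle a b := fun a b => Quotient.eq
  let _ : Fintype Q := Fintype.ofFinite Q
  have hex : ∀ q : Q, ∃ k, ∃ z, κ z = q ∧ levelR Ab Cb k z := by
    intro q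
    obtain ⟨z, rfl⟩ := Quotient.exists_rep q
    obtain ⟨k, hk⟩ := hlev z
    exact ⟨k, z, rfl, hk⟩
  let d : Q → ℕ := fun q => Nat.find (hex q)
  have hd : ∀ q, ∃ z, κ z = q ∧ levelR Ab Cb (d q) z := fun q => Nat.find_spec (hex q)
  have hdmin : ∀ k z, levelR Ab Cb k z → d (κ z) ≤ k := fun k z h =>
    Nat.find_min' (hex (κ z)) ⟨z, rfl, h⟩
  have hep : ∀ q, ∃ ep : (Fin n ⊕ Fin m) × (Fin n ⊕ Fin m), d q ≠ 0 →
      κ ep.1 = q ∧ d (κ ep.2) < d q ∧ soEdgeB Ab Cb ep.1 ep.2 := by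
    intro q
    obtain ⟨z, hz, hl⟩ := hd q
    by_cases h0 : d q = 0
    · exact ⟨(z, z), fun h => absurd h0 h⟩
    · obtain ⟨k, hk⟩ := Nat.exists_eq_succ_of_ne_zero h0
      rw [hk] at hl
      obtain ⟨z', h1, h2⟩ := hl
      refine ⟨(z, z'), fun _ => ⟨hz, ?_, h1⟩⟩
      have := hdmin k z' h2
      show d (κ z') < d q
      omega
  choose ep hep using hep
  let e := fun q => (ep q).1
  let p := fun q => (ep q).2
  let w : Q → ℝ := fun q => ((Fintype.equivFin Q q : ℕ) : ℝ) + 1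
  have hw : ∀ q, 0 < w q := fun q => by positivity
  have hwi : Function.Injective w := by
    intro a b hab
    have h1 : ((Fintype.equivFin Q a : ℕ) : ℝ) = ((Fintype.equivFin Q b : ℕ) : ℝ) :=
      add_right_cancel hab
    exact (Fintype.equivFin Q).injective (Fin.ext (by exact_mod_cast h1))
  let W : (Fin n ⊕ Fin m) → Fin n → ℝ := fun z i =>
    (if Sum.inl i = σ.symm z then w (κ (Sum.inl i)) else 0) +
      ∑ q, if Sum.inl i = e q then (if d q ≠ 0 ∧ p q = z then 1 else 0) else 0
  have hWe : ∀ z i, ¬ soEdgeB Ab Cb (Sum.inl i) z → W z i = 0 := by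
    intro z i hne
    have h1 : ¬ (Sum.inl i = σ.symm z) := by
      intro h
      apply hne
      have h2 := hfe i
      rwa [← hσ, show σ (Sum.inl i) = z by rw [h, Equiv.apply_symm_apply]] at h2
    show (if _ then _ else _) + _ = _
    rw [if_neg h1, zero_add]
    apply Finset.sum_eq_zero
    intro q _
    split_ifs with h2 h3
    · exfalso
      have := (hep q h3.1).2.2
      change soEdgeB Ab Cb (e q) (p q) at this
      rw [← h2, h3.2] at this
      exact hne this
    · rfl
    · rfl
  refine ⟨Matrix.of fun j i => W (Sum.inl j) i, Matrix.of fun j i => W (Sum.inr j) i, ?_, ?_, ?_⟩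
  · intro j i h
    exact hWe _ _ (by simp [soEdgeB, h])
  · intro j i h
    exact hWe _ _ (by simp [soEdgeB, h])
  generalize hA : (Matrix.of fun j i => W (Sum.inl j) i : Matrix (Fin n) (Fin n) ℝ) = A
  generalize hC : (Matrix.of fun j i => W (Sum.inr j) i : Matrix (Fin m) (Fin n) ℝ) = C
  rw [obs_inj]
  intro v0 hv0
  by_contra hne
  obtain ⟨l, v, hv, h1, h2⟩ := exists_eig A C v0 hne hv0
  apply hv
  let u : Fin n ⊕ Fin m → ℂ := Sum.elim v 0
  have hsum : ∀ (g : Fin n ⊕ Fin m → ℂ) (x : Fin n ⊕ Fin m),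
      ∑ i, (if Sum.inl i = x then g (Sum.inl i) else 0) * v i = g x * u x := by
    intro g x
    have : ∑ y, (if y = x then g y else 0) * u y = g x * u x := by simp
    rw [← this, Fintype.sum_sum_type]
    simp [u]
  have hWu : ∀ z, ∑ i, (W z i : ℂ) * v i = l * u z := by
    rintro (j | j)
    · have := congrFun h1 j
      simpa [← hA, Matrix.mulVec, dotProduct, u] using this
    · have := congrFun h2 j
      simpa [← hC, Matrix.mulVec, dotProduct, u] using this
  have hu : u = 0 := by
    apply core_zero σ κ hκ e p d (fun q h => (hep q h).1) (fun q h => (hep q h).2.1) w hw hwi l u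
    · intro q hq
      obtain ⟨z, hz, hl⟩ := hd q
      rw [hq] at hl
      obtain ⟨y, rfl⟩ := hl
      exact ⟨_, hz, rfl⟩
    · intro z
      rw [← hWu]
      simp only [W, Complex.ofReal_add, add_mul, Finset.sum_add_distrib, Equiv.symm_apply_apply,
        Complex.ofReal_sum, Finset.sum_mul]
      congr 1
      · rw [← hsum (fun x => (w (κ x) : ℂ)) z]
        apply Finset.sum_congr rfl
        intro i _
        split_ifs <;> simp
      · rw [Finset.sum_comm]
        apply Finset.sum_congr rfl
        intro q _
        have := hsum (fun _ => if d q ≠ 0 ∧ p q = σ z then 1 else 0) (e q)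
        rw [ite_mul, one_mul, zero_mul] at this
        rw [← this]
        apply Finset.sum_congr rfl
        intro i _
        congr 1
        split_ifs <;> simp
  funext i
  exact congrFun hu (Sum.inl i)

/-- a pattern pair `(Ā, C̄)` is structurally observable iff
(i) from every state vertex there is a directed path in `D(Ā, C̄)` to some output vertex, and
(ii) the bipartite representation `B(Ā, C̄)` admits a matching in which every left state
vertex is matched (encoded as an injective assignment `f` of right vertices along edges). -/
theorem stmt4 {n m : ℕ} (Ab : Matrix (Fin n) (Fin n) Bool)
    (Cb : Matrix (Fin m) (Fin n) Bool) :
    StructObservable Ab Cb ↔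
      ((∀ i : Fin n, ∃ j : Fin m,
          Relation.ReflTransGen (soEdgeB Ab Cb) (Sum.inl i) (Sum.inr j)) ∧
        ∃ f : Fin n → Fin n ⊕ Fin m,
          Function.Injective f ∧ ∀ i : Fin n, soEdgeB Ab Cb (Sum.inl i) (f i)) := by
  constructor
  · rintro ⟨A, C, hA, hC, h⟩
    rw [obs_inj] at h
    exact ⟨fun i => nec_reach Ab Cb A C hA hC h i, nec_match Ab Cb A C hA hC h⟩
  · rintro ⟨h1, f, hf, hfe⟩
    exact suff Ab Cb h1 f hf hfe
end

section
/- Let (Ā ∈ {0,1}^{n×n}, C̄ ∈ {0,1}^{m×n}) be a structurally observable pattern pair, let S_A = {(i,j) : Ā_{ij} = 1} and S_C = {(i,j) : C̄_{ij} = 1}, and parametrize realizations by (a, c) ∈ ℝ^{S_A} × ℝ^{S_C}, where A(a) has entry a_{(i,j)} at position (i,j) ∈ S_A and 0 elsewhere, and C(c) has entry c_{(i,j)} at position (i,j) ∈ S_C and 0 elsewhere. Then the set of (a, c) for which the pair (A(a), C(c)) is NOT observable has Lebesgue measure zero in ℝ^{S_A} × ℝ^{S_C}; i.e., almost all realizations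 compatible with a structurally observable pattern are observable. -/
open Matrix MeasureTheory

/-- The realization of a pattern determined by free parameters at its nonzero positions. -/
def realization {α β : Type*} [DecidableEq α] [DecidableEq β] (P : Matrix α β Bool)
    (a : {e : α × β // P e.1 e.2 = true} → ℝ) : Matrix α β ℝ :=
  Matrix.of fun i j => if h : P i j = true then a ⟨(i, j), h⟩ else 0


lemma null_zeros_of_line_poly {E : Type*} [NormedAddCommGroup E] [NormedSpace ℝ E]
    [FiniteDimensional ℝ E] [MeasurableSpace E] [BorelSpace E]
    (μ : Measure E) [μ.IsAddHaarMeasure] (f : E → ℝ) (hf : Continuous f) (x₀ : E)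
    (hx₀ : f x₀ ≠ 0)
    (hp : ∀ x : E, ∃ q : Polynomial ℝ, ∀ t : ℝ, f (x₀ + t • x) = q.eval t) :
    μ {x | f x = 0} = 0 := by
  have hSm : MeasurableSet {p : ℝ × E | f (x₀ + p.1 • p.2) = 0} := by
    apply IsClosed.measurableSet
    exact isClosed_eq (by fun_prop) continuous_const
  have h1 : ((volume : Measure ℝ).prod μ) {p : ℝ × E | f (x₀ + p.1 • p.2) = 0} = 0 := by
    rw [Measure.prod_apply_symm hSm]
    rw [lintegral_eq_zero_iff' (measurable_measure_prodMk_right hSm).aemeasurable]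
    refine Filter.Eventually.of_forall fun y => ?_
    obtain ⟨q, hq⟩ := hp y
    have hq0 : q ≠ 0 := by
      rintro rfl
      have := hq 0
      simp at this
      exact hx₀ this
    refine Set.Finite.measure_zero ?_ _
    refine (q.roots.toFinset.finite_toSet).subset ?_
    intro t ht
    simp only [Set.mem_preimage, Set.mem_ofPred_eq, hq] at ht
    simp [hq0, ht]
  rw [Measure.measure_prod_null hSm] at h1
  have h2 : ∀ᵐ t : ℝ, t ≠ 0 := by
    simp [ae_iff]
  obtain ⟨t, ht, ht0⟩ := (h1.and h2).exists
  have h3 : μ ((fun y => t • y) ⁻¹' ((fun y => x₀ + y) ⁻¹' {x | f x = 0})) = 0 := ht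
  rw [Measure.addHaar_preimage_smul μ ht0, measure_preimage_add, mul_eq_zero] at h3
  rcases h3 with h3 | h3
  · simp [ht0] at h3
  · exact h3

/-- Gram determinant of the observability matrix, over a general commutative ring. -/
def gramDet {R : Type*} [CommRing R] {n m : ℕ} (A : Matrix (Fin n) (Fin n) R)
    (C : Matrix (Fin m) (Fin n) R) : R :=
  (∑ k ∈ Finset.range n, (C * A ^ k)ᵀ * (C * A ^ k)).det

lemma gramDet_map {R S : Type*} [CommRing R] [CommRing S] (φ : R →+* S) {n m : ℕ}
    (A : Matrix (Fin n) (Fin n) R) (C : Matrix (Fin m) (Fin n) R) :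
    φ (gramDet A C) = gramDet (A.map φ) (C.map φ) := by
  unfold gramDet
  rw [RingHom.map_det, map_sum]
  congr 1
  refine Finset.sum_congr rfl fun k _ => ?_
  rw [RingHom.mapMatrix_apply, Matrix.map_mul, Matrix.transpose_map, Matrix.map_mul,
    Matrix.map_pow]

lemma isObservable_iff {n m : ℕ} (A : Matrix (Fin n) (Fin n) ℝ)
    (C : Matrix (Fin m) (Fin n) ℝ) : IsObservable A C ↔ gramDet A C ≠ 0 := by
  have h : (obsMat A C)ᵀ * obsMat A C =
      ∑ k ∈ Finset.range n, (C * A ^ k)ᵀ * (C * A ^ k) := by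
    ext i j
    rw [Matrix.sum_apply, Matrix.mul_apply, Fintype.sum_prod_type,
      ← Fin.sum_univ_eq_sum_range (fun k => ((C * A ^ k)ᵀ * (C * A ^ k)) i j) n]
    simp only [obsMat, Matrix.transpose_apply, Matrix.of_apply, Matrix.mul_apply (M := (_)ᵀ)]
    exact Fintype.sum_equiv (finCongr (Fintype.card_fin n)) _ _ fun k => rfl
  unfold IsObservable gramDet
  rw [← Matrix.rank_transpose_mul_self, h, ← isUnit_iff_ne_zero, ← Matrix.isUnit_iff_isUnit_det]
  constructor
  · intro hr
    rw [← Matrix.linearIndependent_rows_iff_isUnit, linearIndependent_iff_card_eq_finrank_span, Set.finrank,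
      ← Matrix.rank_eq_finrank_span_row, hr]
  · exact fun hu => Matrix.rank_of_isUnit _ hu

lemma realization_line {α β : Type*} [DecidableEq α] [DecidableEq β] (P : Matrix α β Bool)
    (a b : {e : α × β // P e.1 e.2 = true} → ℝ) (t : ℝ) :
    realization P (a + t • b) =
      (Matrix.of fun i j => Polynomial.C (realization P a i j) +
        Polynomial.X * Polynomial.C (realization P b i j)).map (Polynomial.evalRingHom t) := by
  ext i j
  by_cases h : P i j = true
  · simp [realization, h]
    ring
  · simp [realization, h]

lemma continuous_realization {α β : Type*} [DecidableEq α] [DecidableEq β]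
    (P : Matrix α β Bool) : Continuous (realization P) := by
  refine continuous_matrix fun i j => ?_
  by_cases h : P i j = true
  · simp only [realization, Matrix.of_apply, h, dite_true]
    fun_prop
  · simp only [realization, Matrix.of_apply, h]
    exact continuous_const

lemma realization_self {α β : Type*} [DecidableEq α] [DecidableEq β]
    (P : Matrix α β Bool) (A : Matrix α β ℝ) (h : ∀ i j, P i j = false → A i j = 0) :
    realization P (fun e => A e.1.1 e.1.2) = A := by
  ext i j
  by_cases hP : P i j = true
  · simp [realization, hP]
  · simp [realization, hP, h i j (by simpa using hP)]

/-- if the pattern pair `(Ā, C̄)` is structurally observable, then the set of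
parameters `(a, c) ∈ ℝ^{S_A} × ℝ^{S_C}` (indexed by the nonzero positions of the patterns)
whose realization `(A(a), C(c))` is not observable has Lebesgue measure zero. -/
theorem stmt8 {n m : ℕ} (Ab : Matrix (Fin n) (Fin n) Bool) (Cb : Matrix (Fin m) (Fin n) Bool)
    (hso : StructObservable Ab Cb) :
    volume {p : ({e : Fin n × Fin n // Ab e.1 e.2 = true} → ℝ) ×
              ({e : Fin m × Fin n // Cb e.1 e.2 = true} → ℝ) |
        ¬ IsObservable (realization Ab p.1) (realization Cb p.2)} = 0 := by
  obtain ⟨A, C, hA, hC, hobs⟩ := hso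
  simp only [isObservable_iff, not_not]
  rw [Measure.volume_eq_prod]
  haveI i1 : (volume : Measure ({e : Fin n × Fin n // Ab e.1 e.2 = true} → ℝ)).IsAddHaarMeasure :=
    inferInstance
  haveI i2 : (volume : Measure ({e : Fin m × Fin n // Cb e.1 e.2 = true} → ℝ)).IsAddHaarMeasure :=
    inferInstance
  haveI i3 := Measure.prod.instIsAddHaarMeasure
    (volume : Measure ({e : Fin n × Fin n // Ab e.1 e.2 = true} → ℝ))
    (volume : Measure ({e : Fin m × Fin n // Cb e.1 e.2 = true} → ℝ))
  refine null_zeros_of_line_poly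
    (E := ({e : Fin n × Fin n // Ab e.1 e.2 = true} → ℝ) ×
              ({e : Fin m × Fin n // Cb e.1 e.2 = true} → ℝ)) (volume.prod volume)
    (fun p => gramDet (realization Ab p.1) (realization Cb p.2)) ?_
    (fun e => A e.1.1 e.1.2, fun e => C e.1.1 e.1.2) ?_ ?_
  · have h1 := continuous_realization Ab
    have h2 := continuous_realization Cb
    unfold gramDet
    refine Continuous.matrix_det ?_
    refine continuous_finsetSum _ fun k _ => ?_
    have h3 : Continuous fun p : ({e : Fin n × Fin n // Ab e.1 e.2 = true} → ℝ) ×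
              ({e : Fin m × Fin n // Cb e.1 e.2 = true} → ℝ) =>
        realization Cb p.2 * realization Ab p.1 ^ k :=
      (h2.comp continuous_snd).matrix_mul ((h1.comp continuous_fst).pow k)
    exact h3.matrix_transpose.matrix_mul h3
  · simp only [realization_self Ab A hA, realization_self Cb C hC]
    exact (isObservable_iff A C).1 hobs
  · intro x
    refine ⟨gramDet (Matrix.of fun i j =>
        Polynomial.C (realization Ab (fun e => A e.1.1 e.1.2) i j) +
          Polynomial.X * Polynomial.C (realization Ab x.1 i j))
      (Matrix.of fun i j =>
        Polynomial.C (realization Cb (fun e => C e.1.1 e.1.2) i j) +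
          Polynomial.X * Polynomial.C (realization Cb x.2 i j)), fun t => ?_⟩
    rw [← Polynomial.coe_evalRingHom, gramDet_map, ← realization_line, ← realization_line]
    rfl
end
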